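/- Let T be a finite tree with at least three vertices. Then the domination subdivision number of T equals 3 (i.e., sd(T) = 3) if and only if T belongs to the family 𝓕 of labeled trees. -/

import Mathlib

open SimpleGraph

namespace GenCorona

universe u

/-- A vertex neighborhood partition of a graph `G`: for every vertex `v`, a partition
of the open neighborhood `N_G(v)` into nonempty sets. -/
structure NbhdPartition {V : Type u} (G : SimpleGraph V) where
  part : V → Set (Set V)
  nonempty : ∀ v : V, ∀ A ∈ part v, A.Nonempty
  subset_nbhd : ∀ v : V, ∀ A ∈ part v, A ⊆ G.neighborSet v
  covers : ∀ v : V, ∀ u ∈ G.neighborSet v, ∃ A ∈ part v, u ∈ A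
  eq_of_inter : ∀ v : V, ∀ A ∈ part v, ∀ B ∈ part v, (A ∩ B).Nonempty → A = B

variable {V : Type u}

/-- The vertex type of the general corona `G ∘ 𝒫`: external vertices `(v,1)` are encoded
as `Sum.inl v`, internal vertices `(v,A)` (with `A ∈ 𝒫(v)`) as `Sum.inr ⟨(v,A), _⟩`. -/
abbrev CoronaVert (G : SimpleGraph V) (P : NbhdPartition G) : Type u :=
  V ⊕ {p : V × Set V // p.2 ∈ P.part p.1}

/-- The general corona `G ∘ 𝒫`. -/
def corona (G : SimpleGraph V) (P : NbhdPartition G) : SimpleGraph (CoronaVert G P) :=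
  SimpleGraph.fromRel fun x y =>
    match x, y with
    | Sum.inl v, Sum.inr p => v = p.val.1
    | Sum.inr p, Sum.inr q =>
        G.Adj p.val.1 q.val.1 ∧ q.val.1 ∈ p.val.2 ∧ p.val.1 ∈ q.val.2
    | _, _ => False

/-- The set of external vertices of the general corona. -/
def Ext (G : SimpleGraph V) (P : NbhdPartition G) : Set (CoronaVert G P) :=
  Set.range Sum.inl

/-- A graph is a general corona of a tree if it is isomorphic to `T ∘ 𝒫` for some finite
tree `T` and some vertex neighborhood partition `𝒫` of `T`. -/
def IsGeneralCoronaOfTree {W : Type*} (H : SimpleGraph W) : Prop :=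
  ∃ (n : ℕ) (T : SimpleGraph (Fin n)) (P : NbhdPartition T),
    T.IsTree ∧ Nonempty (H ≃g corona T P)

/-- A graph `H` is a general corona of a tree with external vertex set `E`. -/
def IsGenCoronaWithExt {W : Type*} (H : SimpleGraph W) (E : Set W) : Prop :=
  ∃ (n : ℕ) (T : SimpleGraph (Fin n)) (P : NbhdPartition T),
    T.IsTree ∧ ∃ f : H ≃g corona T P, E = ⇑f ⁻¹' Ext T P

/-- `D` is a dominating set of `G`. -/
def IsDominating (G : SimpleGraph V) (D : Set V) : Prop :=
  ∀ v ∉ D, ∃ u ∈ D, G.Adj v u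

/-- `S` is a 2-packing of `G`: any two distinct vertices of `S` are at distance
greater than 2 (where the extended distance of unreachable vertices is `⊤`). -/
def Is2Packing (G : SimpleGraph V) (S : Set V) : Prop :=
  ∀ u ∈ S, ∀ v ∈ S, u ≠ v → 2 < G.edist u v

/-- A leaf is a vertex of degree 1, i.e. with exactly one neighbor. -/
def IsLeaf (G : SimpleGraph V) (v : V) : Prop :=
  (G.neighborSet v).ncard = 1

/-- The domination number: the minimum size of a dominating set. -/
noncomputable def dominationNumber (G : SimpleGraph V) : ℕ :=
  sInf {n : ℕ | ∃ D : Set V, IsDominating G D ∧ D.ncard = n}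

/-- The graph obtained from `G` by subdividing every edge in `F` (each once):
for each `e ∈ F` a new vertex `Sum.inr e` replaces the edge `e` by a path of length two. -/
def subdivide (G : SimpleGraph V) (F : Set (Sym2 V)) : SimpleGraph (V ⊕ F) :=
  SimpleGraph.fromRel fun x y =>
    match x, y with
    | Sum.inl u, Sum.inl v => G.Adj u v ∧ s(u, v) ∉ F
    | Sum.inl u, Sum.inr e => u ∈ e.val
    | _, _ => False

/-- The domination subdivision number `sd(G)`: the minimum number of edges which must be
subdivided (each edge at most once) in order to increase the domination number. -/
noncomputable def sd (G : SimpleGraph V) : ℕ :=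
  sInf {k : ℕ | ∃ F : Set (Sym2 V), F ⊆ G.edgeSet ∧ F.ncard = k ∧
    dominationNumber G < dominationNumber (subdivide G F)}

/-- The corona `G ∘ K₁`: attach one new pendant vertex `Sum.inr v` to each vertex
`Sum.inl v` of `G`. -/
def coronaK1 (G : SimpleGraph V) : SimpleGraph (V ⊕ V) :=
  SimpleGraph.fromRel fun x y =>
    match x, y with
    | Sum.inl u, Sum.inl w => G.Adj u w
    | Sum.inl u, Sum.inr w => u = w
    | _, _ => False

/-- The 2-subdivision `S₂(G)`: every edge `uv` is replaced by a path `(u, x₁, x₂, v)`;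
the new vertex `Sum.inr ⟨(u,v), _⟩` is the subdivision vertex adjacent to `u`. -/
def twoSubdivision (G : SimpleGraph V) : SimpleGraph (V ⊕ {p : V × V // G.Adj p.1 p.2}) :=
  SimpleGraph.fromRel fun x y =>
    match x, y with
    | Sum.inl u, Sum.inr p => u = p.val.1
    | Sum.inr p, Sum.inr q => p.val.1 = q.val.2 ∧ p.val.2 = q.val.1
    | _, _ => False

/-- `𝒫'` is a refinement of `𝒫`. -/
def Refines {G : SimpleGraph V} (P' P : NbhdPartition G) : Prop :=
  ∀ v : V, ∀ A ∈ P'.part v, ∃ B ∈ P.part v, A ⊆ B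

/-- The graph obtained by contracting the two vertices `x` and `y` of `G` to the single
vertex `x` (the vertex `y` is removed, and `x` becomes adjacent to all former
neighbors of `y`). -/
def contractPair {W : Type*} (G : SimpleGraph W) (x y : W) :
    SimpleGraph {w : W // w ≠ y} :=
  SimpleGraph.fromRel fun a b =>
    G.Adj a.val b.val ∨ (a.val = x ∧ G.Adj y b.val) ∨ (b.val = x ∧ G.Adj a.val y)

/-- The graph obtained from `G` by attaching a path `(x, y, z)` (encoded as
`Sum.inr 0, Sum.inr 1, Sum.inr 2`) to the vertex `v` via the edge `v x`. -/
def attachPath3 {W : Type*} (G : SimpleGraph W) (v : W) : SimpleGraph (W ⊕ Fin 3) :=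
  SimpleGraph.fromRel fun a b =>
    match a, b with
    | Sum.inl u, Sum.inl w => G.Adj u w
    | Sum.inl u, Sum.inr i => u = v ∧ i = 0
    | Sum.inr i, Sum.inr j => (i = 0 ∧ j = 1) ∨ (i = 1 ∧ j = 2)
    | _, _ => False

/-- The graph obtained from `G` by attaching a path `(x, y)` (encoded as
`Sum.inr 0, Sum.inr 1`) to the vertex `v` via the edge `v x`. -/
def attachPath2 {W : Type*} (G : SimpleGraph W) (v : W) : SimpleGraph (W ⊕ Fin 2) :=
  SimpleGraph.fromRel fun a b =>
    match a, b with
    | Sum.inl u, Sum.inl w => G.Adj u w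
    | Sum.inl u, Sum.inr i => u = v ∧ i = 0
    | Sum.inr i, Sum.inr j => i = 0 ∧ j = 1
    | _, _ => False

/-- The family `𝓕` of labeled trees; the label of a vertex is `A` when it belongs to the
distinguished set `L`, and `B` otherwise.  The family contains the labeled path `P₄`
(leaves labeled `A`, support vertices labeled `B`) and is closed under the two
attachment operations. -/
inductive LabF : ∀ {W : Type}, SimpleGraph W → Set W → Prop where
  | base : LabF (SimpleGraph.pathGraph 4) ({0, 3} : Set (Fin 4))
  | opA {W : Type} {G : SimpleGraph W} {L : Set W} (v : W) :
      LabF G L → v ∈ L →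
        LabF (attachPath3 G v) (Sum.inl '' L ∪ {Sum.inr (2 : Fin 3)})
  | opB {W : Type} {G : SimpleGraph W} {L : Set W} (v : W) :
      LabF G L → v ∉ L →
        LabF (attachPath2 G v) (Sum.inl '' L ∪ {Sum.inr (1 : Fin 2)})

/-- A tree `T` belongs to the family `𝓕` if it admits a labeling constructed by the
above rules, i.e. it is isomorphic to a member of the inductively generated family. -/
def MemF {W : Type*} (T : SimpleGraph W) : Prop :=
  ∃ (W' : Type) (G : SimpleGraph W') (L : Set W'), LabF G L ∧ Nonempty (T ≃g G)

section Subdivide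

variable {G : SimpleGraph V} {F : Set (Sym2 V)}

@[simp] lemma subdivide_adj_inl_inl {u v : V} :
    (subdivide G F).Adj (Sum.inl u) (Sum.inl v) ↔ G.Adj u v ∧ s(u, v) ∉ F := by
  simp only [subdivide, fromRel_adj, Sym2.eq_swap (a := v), G.adj_comm v u, or_self]
  exact ⟨fun h => h.2, fun h => ⟨fun e => h.1.ne (Sum.inl_injective e), h⟩⟩

@[simp] lemma subdivide_adj_inl_inr {u : V} {e : F} :
    (subdivide G F).Adj (Sum.inl u) (Sum.inr e) ↔ u ∈ e.val := by
  simp [subdivide]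

@[simp] lemma subdivide_adj_inr_inl {u : V} {e : F} :
    (subdivide G F).Adj (Sum.inr e) (Sum.inl u) ↔ u ∈ e.val := by
  simp [subdivide]

@[simp] lemma not_subdivide_adj_inr_inr {e f : F} :
    ¬ (subdivide G F).Adj (Sum.inr e) (Sum.inr f) := by
  simp [subdivide]

end Subdivide

section Packing

/-- Closed neighborhoods of distinct elements of `P` are disjoint. -/
def IsPacking (G : SimpleGraph V) (P : Set V) : Prop :=
  ∀ u ∈ P, ∀ v ∈ P, ∀ w, (w = u ∨ G.Adj w u) → (w = v ∨ G.Adj w v) → u = v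

variable {G : SimpleGraph V}

lemma dominationNumber_le {D : Set V} (hD : IsDominating G D) :
    dominationNumber G ≤ D.ncard :=
  Nat.sInf_le ⟨D, hD, rfl⟩

lemma exists_isDominating_ncard_eq (G : SimpleGraph V) :
    ∃ D : Set V, IsDominating G D ∧ D.ncard = dominationNumber G :=
  Nat.sInf_mem (s := {n : ℕ | ∃ D : Set V, IsDominating G D ∧ D.ncard = n})
    ⟨_, Set.univ, fun v hv => (hv (Set.mem_univ v)).elim, rfl⟩

lemma IsPacking.ncard_le [Finite V] {P : Set V} (hP : IsPacking G P) :
    P.ncard ≤ dominationNumber G := by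
  obtain ⟨D, hD, hcard⟩ := exists_isDominating_ncard_eq G
  rw [← hcard]
  have hdom : ∀ v, ∃ u ∈ D, u = v ∨ G.Adj u v := fun v => by
    by_cases hv : v ∈ D
    · exact ⟨v, hv, Or.inl rfl⟩
    · obtain ⟨u, hu, h⟩ := hD v hv
      exact ⟨u, hu, Or.inr h.symm⟩
  choose f hf hfv using hdom
  refine Set.ncard_le_ncard_of_injOn f (fun v _ => hf v) (fun u hu v hv huv => ?_) D.toFinite
  exact hP u hu v hv (f u) (hfv u) (huv ▸ hfv v)

lemma IsPacking.isPacking_subdivide {S : Set V} (hS : IsPacking G S) {F : Set (Sym2 V)}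
    (hF : F ⊆ G.edgeSet) {u v : V} (hu : u ∉ S) (hv : v ∉ S) (huv : s(u, v) ∈ F)
    (hFu : ∀ s ∈ S, G.Adj u s → s(u, s) ∈ F) (hFv : ∀ s ∈ S, G.Adj v s → s(v, s) ∈ F) :
    IsPacking (subdivide G F) (insert (Sum.inr ⟨s(u, v), huv⟩) (Sum.inl '' S)) := by
  have key : ∀ s ∈ S, ∀ w, (w = Sum.inl s ∨ (subdivide G F).Adj w (Sum.inl s)) →
      ¬ (w = Sum.inr ⟨s(u, v), huv⟩ ∨
        (subdivide G F).Adj w (Sum.inr ⟨s(u, v), huv⟩)) := by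
    rintro s hs (w | ⟨e, he⟩) h1 h2
    · simp at h1 h2
      grind
    · simp at h1 h2
      grind
  rintro _ (rfl | ⟨s, hs, rfl⟩) _ (rfl | ⟨t, ht, rfl⟩) w h1 h2
  · rfl
  · exact (key t ht w h2 h1).elim
  · exact (key s hs w h1 h2).elim
  · congr 1
    rcases w with w | ⟨e, he⟩
    · simp at h1 h2
      exact hS s hs t ht w (h1.imp_right And.left) (h2.imp_right And.left)
    · simp at h1 h2
      by_contra hne
      have : e = s(s, t) := (Sym2.mem_and_mem_iff hne).1 ⟨h1, h2⟩
      subst this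
      exact hne (hS s hs t ht s (Or.inl rfl) (Or.inr (hF he)))

lemma IsPacking.ncard_lt_dominationNumber_subdivide [Finite V] {S : Set V} (hS : IsPacking G S)
    {F : Set (Sym2 V)} (hF : F ⊆ G.edgeSet) {u v : V} (hu : u ∉ S) (hv : v ∉ S)
    (huv : s(u, v) ∈ F) (hFu : ∀ s ∈ S, G.Adj u s → s(u, s) ∈ F)
    (hFv : ∀ s ∈ S, G.Adj v s → s(v, s) ∈ F) :
    S.ncard < dominationNumber (subdivide G F) := by
  have h := (hS.isPacking_subdivide hF hu hv huv hFu hFv).ncard_le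
  rwa [Set.ncard_insert_of_notMem (by simp), Set.ncard_image_of_injective _ Sum.inl_injective] at h

end Packing

section Rooted

/-- `G` is a tree rooted at `r` in which the parent of a vertex `v ≠ r` is `par v`. -/
structure IsRooted (G : SimpleGraph V) (r : V) (par : V → V) (depth : V → ℕ) : Prop where
  par_root : par r = r
  adj_iff : ∀ u v, G.Adj u v ↔ (u ≠ r ∧ par u = v) ∨ (v ≠ r ∧ par v = u)
  depth_par : ∀ v, v ≠ r → depth v = depth (par v) + 1

lemma exists_isRooted {G : SimpleGraph V} (hG : G.IsTree) (r : V) :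
    ∃ par, IsRooted G r par (G.dist r) := by
  have key : ∀ v, ∃ p, (v = r → p = r) ∧ (v ≠ r → G.Adj v p ∧
      ∀ w, G.Adj v w → G.dist r v = G.dist r w + 1 → w = p) := by
    intro v
    by_cases hv : v = r
    · exact ⟨r, fun _ => rfl, fun h => (h hv).elim⟩
    obtain ⟨p, hp, -⟩ := hG.existsUnique_path v r
    refine ⟨p.snd, fun h => (hv h).elim, fun _ => ⟨p.adj_snd (Walk.not_nil_of_ne hv), ?_⟩⟩
    intro w hvw hd
    obtain ⟨q, hq⟩ := (hG.connected w r).exists_walk_length_eq_dist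
    have hq' : (Walk.cons hvw q).IsPath := by
      apply Walk.isPath_of_length_eq_dist
      rw [Walk.length_cons, hq, dist_comm, ← hd, dist_comm]
    have := (hG.existsUnique_path v r).unique hp hq'
    simp [this]
  choose par h1 h2 using key
  have hdist : ∀ v, v ≠ r → G.dist r v = G.dist r (par v) + 1 := by
    intro v hv
    obtain ⟨q, hq⟩ := (hG.connected v r).exists_walk_length_eq_dist
    cases q with
    | nil => exact (hv rfl).elim
    | @cons _ w _ h q =>
      have hw : G.dist r v = G.dist r w + 1 := by
        have := hG.dist_eq_dist_add_one_of_adj r h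
        have := dist_le q
        rw [Walk.length_cons] at hq
        rw [dist_comm] at this hq
        omega
      rwa [← (h2 v hv).2 w h hw]
  refine ⟨par, h1 r rfl, fun u v => ⟨fun h => ?_, ?_⟩, hdist⟩
  · rcases hG.dist_eq_dist_add_one_of_adj r h with hd | hd
    · have hu : u ≠ r := by rintro rfl; simp at hd
      exact Or.inl ⟨hu, ((h2 u hu).2 v h hd).symm⟩
    · have hv : v ≠ r := by rintro rfl; simp at hd
      exact Or.inr ⟨hv, ((h2 v hv).2 u h.symm hd).symm⟩
  · rintro (⟨hu, rfl⟩ | ⟨hv, rfl⟩)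
    · exact (h2 u hu).1
    · exact (h2 v hv).1.symm

variable {G : SimpleGraph V} {r : V} {par : V → V} {depth : V → ℕ}

lemma IsRooted.adj_par (h : IsRooted G r par depth) {v : V} (hv : v ≠ r) : G.Adj v (par v) :=
  (h.adj_iff _ _).2 (Or.inl ⟨hv, rfl⟩)

/-- In a rooted tree every set `X` of vertices contains a packing that is at least as large as
some set dominating `X`. -/
lemma IsRooted.exists_packing_aux [Finite V] (h : IsRooted G r par depth) (n : ℕ) :
    ∀ X : Set V, X.ncard = n → ∃ P D : Set V, P ⊆ X ∧ IsPacking G P ∧ D.ncard ≤ P.ncard ∧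
      ∀ x ∈ X, ∃ d ∈ D, x = d ∨ G.Adj x d := by
  induction n using Nat.strong_induction_on with
  | _ n ih =>
  intro X hX
  rcases X.eq_empty_or_nonempty with rfl | hne
  · exact ⟨∅, ∅, by simp, by simp [IsPacking], le_rfl, by simp⟩
  obtain ⟨x, hx, hmax⟩ := Set.exists_max_image X depth X.toFinite hne
  obtain ⟨P, D, hPX, hP, hDP, hD⟩ := ih _ (by
    rw [← hX]
    refine Set.ncard_lt_ncard (t := X)
      (s := X \ {y | y = par x ∨ G.Adj y (par x)}) ⟨Set.sdiff_subset, fun hs => ?_⟩ X.toFinite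
    refine (hs hx).2 ?_
    by_cases hxr : x = r
    · left; rw [hxr, h.par_root]
    · right; exact h.adj_par hxr) _ rfl
  have hxP : ∀ y ∈ P, ∀ w, (w = x ∨ G.Adj w x) → ¬ (w = y ∨ G.Adj w y) := by
    intro y hy w h1 h2
    have hyX := hPX hy
    have hd := hmax y hyX.1
    have hy2 := hyX.2
    have e1 := h.adj_iff
    have e2 := h.depth_par
    have e3 := h.par_root
    simp only [Set.mem_ofPred_eq, not_or] at hy2
    grind
  have hx' : x ∉ P := fun hxP' => hxP x hxP' x (Or.inl rfl) (Or.inl rfl)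
  refine ⟨insert x P, insert (par x) D, ?_, ?_, ?_, ?_⟩
  · exact Set.insert_subset hx (hPX.trans Set.sdiff_subset)
  · rintro u (rfl | hu) v (rfl | hv) w h1 h2
    · rfl
    · exact (hxP v hv w h1 h2).elim
    · exact (hxP u hu w h2 h1).elim
    · exact hP u hu v hv w h1 h2
  · rw [Set.ncard_insert_of_notMem hx']
    exact (Set.ncard_insert_le _ _).trans (by omega)
  · intro y hy
    by_cases hyp : y = par x ∨ G.Adj y (par x)
    · exact ⟨par x, Or.inl rfl, hyp⟩
    · obtain ⟨d, hd, hyd⟩ := hD y ⟨hy, hyp⟩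
      exact ⟨d, Or.inr hd, hyd⟩

lemma IsRooted.exists_packing [Finite V] (h : IsRooted G r par depth) :
    ∃ P : Set V, IsPacking G P ∧ P.ncard = dominationNumber G := by
  obtain ⟨P, D, -, hP, hDP, hD⟩ := h.exists_packing_aux _ Set.univ rfl
  refine ⟨P, hP, hP.ncard_le.antisymm ((dominationNumber_le fun v hv => ?_).trans hDP)⟩
  obtain ⟨d, hd, rfl | hvd⟩ := hD v (Set.mem_univ v)
  · exact (hv hd).elim
  · exact ⟨d, hd, hvd⟩

lemma IsRooted.iterate_depth (h : IsRooted G r par depth) {v x : V} {k : ℕ}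
    (hk : par^[k] v = x) (hx : x ≠ r) : depth v = depth x + k := by
  induction k generalizing v with
  | zero => simp_all
  | succ k ih =>
    have hv : v ≠ r := by
      rintro rfl
      rw [Function.iterate_fixed h.par_root] at hk
      exact hx hk.symm
    rw [h.depth_par v hv, ih (v := par v) (by simpa using hk)]
    omega

lemma IsRooted.dist_iterate_le (h : IsRooted G r par depth) (hG : G.Connected) (v : V) (k : ℕ) :
    G.dist v (par^[k] v) ≤ k := by
  induction k generalizing v with
  | zero => simp
  | succ k ih =>
    rw [Function.iterate_succ_apply]
    have h1 := ih (par v)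
    have h2 : G.dist v (par v) ≤ 1 := by
      by_cases hv : v = r
      · rw [hv, h.par_root]; simp
      · exact (dist_eq_one_iff_adj.2 (h.adj_par hv)).le
    have := hG.dist_triangle (u := v) (v := par v) (w := par^[k] (par v))
    omega

end Rooted

section LeafCode

/-- `L` is a perfect code of `G` that contains all leaves: `L` is independent, every vertex
outside `L` has exactly one neighbor in `L`, and at least one neighbor outside `L`. -/
structure IsLeafCode (G : SimpleGraph V) (L : Set V) : Prop where
  indep : ∀ u ∈ L, ∀ v ∈ L, ¬ G.Adj u v
  exists_mem : ∀ v ∉ L, ∃ u ∈ L, G.Adj v u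
  unique : ∀ v ∉ L, ∀ u ∈ L, ∀ w ∈ L, G.Adj v u → G.Adj v w → u = w
  exists_notMem : ∀ v ∉ L, ∃ u ∉ L, G.Adj v u

variable {G : SimpleGraph V} {L : Set V}

lemma IsLeafCode.isPacking (hL : IsLeafCode G L) : IsPacking G L := by
  intro u hu v hv w h1 h2
  rcases h1 with rfl | h1 <;> rcases h2 with rfl | h2
  · rfl
  · exact (hL.indep _ hu _ hv h2).elim
  · exact (hL.indep _ hv _ hu h1).elim
  · exact hL.unique w (fun hw => hL.indep _ hw _ hu h1) u hu v hv h1 h2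

lemma IsLeafCode.dominationNumber_eq [Finite V] (hL : IsLeafCode G L) :
    dominationNumber G = L.ncard :=
  (dominationNumber_le hL.exists_mem).antisymm hL.isPacking.ncard_le

lemma IsLeafCode.iso {W : Type*} {G' : SimpleGraph W} {L' : Set W} (hL : IsLeafCode G' L')
    (f : G ≃g G') : IsLeafCode G (f ⁻¹' L') where
  indep u hu v hv h := hL.indep _ hu _ hv (f.map_adj_iff.2 h)
  exists_mem v hv := by
    obtain ⟨u, hu, h⟩ := hL.exists_mem _ hv
    refine ⟨f.symm u, by simpa using hu, f.map_adj_iff.1 (by simpa using h)⟩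
  unique v hv u hu w hw h1 h2 :=
    f.injective (hL.unique _ hv _ hu _ hw (f.map_adj_iff.2 h1) (f.map_adj_iff.2 h2))
  exists_notMem v hv := by
    obtain ⟨u, hu, h⟩ := hL.exists_notMem _ hv
    refine ⟨f.symm u, by simpa using hu, f.map_adj_iff.1 (by simpa using h)⟩

/-- Three subdivisions suffice to increase the domination number of a graph with a leaf code. -/
lemma IsLeafCode.sd_le_three [Finite V] (hL : IsLeafCode G L) {v : V} (hv : v ∉ L) :
    ∃ F ⊆ G.edgeSet, F.ncard ≤ 3 ∧ dominationNumber G < dominationNumber (subdivide G F) := by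
  obtain ⟨u, hu, hvu⟩ := hL.exists_notMem v hv
  obtain ⟨s, hs, hvs⟩ := hL.exists_mem v hv
  obtain ⟨t, ht, hut⟩ := hL.exists_mem u hu
  have hF : ({s(v, u), s(v, s), s(u, t)} : Set (Sym2 V)) ⊆ G.edgeSet := by
    rintro _ (rfl | rfl | rfl) <;> assumption
  refine ⟨{s(v, u), s(v, s), s(u, t)}, hF, ?_, ?_⟩
  · exact (Set.ncard_insert_le _ _).trans (Nat.succ_le_succ
      ((Set.ncard_insert_le _ _).trans (by simp)))
  · rw [hL.dominationNumber_eq]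
    refine hL.isPacking.ncard_lt_dominationNumber_subdivide hF hv hu (by simp) ?_ ?_
    · intro x hx hvx
      rw [hL.unique v hv x hx s hs hvx hvs]; simp
    · intro x hx hux
      rw [hL.unique u hu x hx t ht hux hut]; simp

variable {r : V} {par : V → V} {depth : V → ℕ}

/-- Let `S` be a set of non-root vertices closed under taking children. Subdividing all edges
between `S` and its complement does not increase the domination number: replace every element of
`L ∩ S` by its parent in the subdivided tree. -/
lemma IsLeafCode.dominationNumber_subdivide_le_of_closed [Finite V] (hL : IsLeafCode G L)
    (h : IsRooted G r par depth) {S : Set V} (hr : r ∉ S)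
    (hS : ∀ v, v ≠ r → par v ∈ S → v ∈ S) {F : Set (Sym2 V)}
    (hF : ∀ e, e ∈ F ↔ ∃ v ∈ S, par v ∉ S ∧ e = s(v, par v)) :
    dominationNumber (subdivide G F) ≤ dominationNumber G := by
  classical
  set c : V → V ⊕ F := fun v =>
    if hv : v ∈ S ∧ par v ∉ S then Sum.inr ⟨s(v, par v), (hF _).2 ⟨v, hv.1, hv.2, rfl⟩⟩
    else if v ∈ S then Sum.inl (par v) else Sum.inl v with hc
  have c1 : ∀ v (hv : v ∈ S) (hp : par v ∉ S),
      c v = Sum.inr ⟨s(v, par v), (hF _).2 ⟨v, hv, hp, rfl⟩⟩ := fun v hv hp => by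
    simp only [hc]; rw [dif_pos ⟨hv, hp⟩]
  have c2 : ∀ v, v ∈ S → par v ∈ S → c v = Sum.inl (par v) := fun v hv hp => by
    simp only [hc]; rw [dif_neg (fun h => h.2 hp), if_pos hv]
  have c3 : ∀ v, v ∉ S → c v = Sum.inl v := fun v hv => by
    simp only [hc]; rw [dif_neg (fun h => hv h.1), if_neg hv]
  have hFS : ∀ u v, s(u, v) ∈ F → (u ∈ S ↔ v ∉ S) := by
    intro u v huv
    obtain ⟨x, hx, hpx, he⟩ := (hF _).1 huv
    rcases Sym2.eq_iff.1 he with ⟨rfl, rfl⟩ | ⟨rfl, rfl⟩ <;> simp [hx, hpx]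
  have hroot : ∀ v ∈ S, v ≠ r := fun v hv => by rintro rfl; exact hr hv
  have hchild : ∀ v u, v ∈ S → G.Adj v u → par v ≠ u → u ∈ S ∧ par u = v := by
    intro v u hv huv hne
    rcases (h.adj_iff _ _).1 huv with ⟨-, h1⟩ | ⟨h1, h2⟩
    · exact (hne h1).elim
    · exact ⟨hS u h1 (h2 ▸ hv), h2⟩
  have hcL : ∀ v ∈ S, v ∉ L → par v ∉ L → Sum.inl v ∈ c '' L := by
    intro v hv hvL hpL
    obtain ⟨d, hd, hvd⟩ := hL.exists_mem v hvL
    obtain ⟨hdS, hdv⟩ := hchild v d hv hvd (fun e => hpL (e ▸ hd))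
    exact ⟨d, hd, by rw [c2 d hdS (hdv ▸ hv), hdv]⟩
  have hdom : IsDominating (subdivide G F) (c '' L) := by
    rintro (v | ⟨e, he⟩) hvc
    · by_cases hvS : v ∈ S
      · by_cases hvL : v ∈ L
        · refine ⟨c v, ⟨v, hvL, rfl⟩, ?_⟩
          by_cases hp : par v ∈ S
          · rw [c2 v hvS hp, subdivide_adj_inl_inl]
            exact ⟨h.adj_par (hroot v hvS), fun hf => (hFS _ _ hf).1 hvS hp⟩
          · rw [c1 v hvS hp, subdivide_adj_inl_inr]
            simp
        · by_cases hp : par v ∈ L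
          · obtain ⟨u, hu, hvu⟩ := hL.exists_notMem v hvL
            obtain ⟨huS, huv⟩ := hchild v u hvS hvu (fun e => hu (e ▸ hp))
            refine ⟨Sum.inl u, hcL u huS hu (huv ▸ hvL), ?_⟩
            rw [subdivide_adj_inl_inl]
            exact ⟨hvu, fun hf => (hFS _ _ hf).1 hvS huS⟩
          · exact (hvc (hcL v hvS hvL hp)).elim
      · have hvL : v ∉ L := fun hvL => hvc ⟨v, hvL, c3 v hvS⟩
        obtain ⟨d, hd, hvd⟩ := hL.exists_mem v hvL
        refine ⟨c d, ⟨d, hd, rfl⟩, ?_⟩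
        by_cases hdS : d ∈ S
        · have hdv : par d = v := by
            by_contra hne
            exact hvS (hchild d v hdS hvd.symm hne).1
          rw [c1 d hdS (hdv ▸ hvS), subdivide_adj_inl_inr]
          simp [hdv]
        · rw [c3 d hdS, subdivide_adj_inl_inl]
          exact ⟨hvd, fun hf => hvS ((hFS _ _ hf).2 hdS)⟩
    · obtain ⟨x, hx, hpx, rfl⟩ := (hF _).1 he
      by_cases hxL : x ∈ L
      · exact (hvc ⟨x, hxL, c1 x hx hpx⟩).elim
      by_cases hpL : par x ∈ L
      · exact ⟨_, ⟨par x, hpL, c3 _ hpx⟩, by simp⟩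
      · exact ⟨_, hcL x hx hxL hpL, by simp⟩
  rw [hL.dominationNumber_eq]
  exact (dominationNumber_le hdom).trans (Set.ncard_image_le L.toFinite)

/-- The version of `IsLeafCode.dominationNumber_subdivide_le_of_closed` where `S` consists of the
descendants of a set `X` of pairwise incomparable vertices. -/
lemma IsLeafCode.dominationNumber_subdivide_le_of_antichain [Finite V] (hL : IsLeafCode G L)
    (h : IsRooted G r par depth) {X : Set V} (hr : r ∉ X)
    (hX : ∀ x ∈ X, ∀ y ∈ X, ∀ k, par^[k] (par x) ≠ y) :
    dominationNumber (subdivide G ((fun x => s(x, par x)) '' X)) ≤ dominationNumber G := by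
  refine hL.dominationNumber_subdivide_le_of_closed h (S := {v | ∃ k, par^[k] v ∈ X}) ?_ ?_ ?_
  · rintro ⟨k, hk⟩
    rw [Function.iterate_fixed h.par_root] at hk
    exact hr hk
  · rintro v - ⟨k, hk⟩
    exact ⟨k + 1, hk⟩
  · intro e
    constructor
    · rintro ⟨x, hx, rfl⟩
      exact ⟨x, ⟨0, hx⟩, fun ⟨k, hk⟩ => hX x hx _ hk k rfl, rfl⟩
    · rintro ⟨v, ⟨k, hk⟩, hp, rfl⟩
      cases k with
      | zero => exact ⟨v, hk, rfl⟩
      | succ k => exact (hp ⟨k, hk⟩).elim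

lemma IsLeafCode.dominationNumber_subdivide_le [Finite V] (hL : IsLeafCode G L) (hG : G.IsTree)
    {F : Set (Sym2 V)} (hF : F ⊆ G.edgeSet) (hcard : F.ncard ≤ 2) :
    dominationNumber (subdivide G F) ≤ dominationNumber G := by
  rcases Nat.lt_or_ge F.ncard 1 with h0 | h1
  · obtain rfl : F = ∅ := (Set.ncard_eq_zero F.toFinite).1 (by omega)
    obtain ⟨par, h⟩ := exists_isRooted hG hG.connected.nonempty.some
    have := hL.dominationNumber_subdivide_le_of_antichain h (X := ∅) (by simp) (by simp)
    rwa [Set.image_empty] at this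
  -- a one-element set is treated as a pair of equal edges
  obtain ⟨e, f, rfl⟩ : ∃ e f, F = {e, f} := by
    obtain h | h : F.ncard = 1 ∨ F.ncard = 2 := by omega
    · obtain ⟨e, rfl⟩ := Set.ncard_eq_one.1 h
      exact ⟨e, e, by simp⟩
    · obtain ⟨e, f, -, rfl⟩ := Set.ncard_eq_two.1 h
      exact ⟨e, f, rfl⟩
  obtain ⟨⟨p, q⟩, ⟨hp, hq⟩, hmin⟩ := Set.exists_min_image {x : V × V | x.1 ∈ e ∧ x.2 ∈ f}
    (fun x => G.dist x.1 x.2) (Set.toFinite _) ⟨(e.out.1, f.out.1), e.out_fst_mem, f.out_fst_mem⟩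
  obtain ⟨x, rfl⟩ := hp
  obtain ⟨y, rfl⟩ := hq
  have hpx : G.Adj p x := hF (Or.inl rfl)
  have hqy : G.Adj q y := hF (Or.inr rfl)
  obtain ⟨par, h⟩ := exists_isRooted hG p
  have hxq := hmin (x, q) (by simp)
  have hpy := hmin (p, y) (by simp)
  simp only at hxq hpy
  have hparx : par x = p := by
    rcases (h.adj_iff _ _).1 hpx with h1 | h1
    · exact (h1.1 rfl).elim
    · exact h1.2
  have hdy : G.dist p y = G.dist p q + 1 := by
    have := hG.dist_eq_dist_add_one_of_adj p hqy
    omega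
  have hyp : y ≠ p := by rintro rfl; simp at hdy
  have hpary : par y = q := by
    rcases (h.adj_iff _ _).1 hqy with ⟨h1, h2⟩ | h1
    · have := h.depth_par q h1
      rw [h2] at this
      omega
    · exact h1.2
  have hdx : G.dist p x = 1 := dist_eq_one_iff_adj.2 hpx
  have hF' : ({s(p, x), s(q, y)} : Set (Sym2 V)) = (fun x => s(x, par x)) '' {x, y} := by
    rw [Set.image_pair, hparx, hpary, Sym2.eq_swap (a := p), Sym2.eq_swap (a := q)]
  rw [hF']
  refine hL.dominationNumber_subdivide_le_of_antichain h ?_ ?_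
  · rintro (rfl | rfl)
    · exact hpx.ne rfl
    · exact hyp rfl
  · rintro _ (rfl | rfl) z hz k hk
    · rw [hparx, Function.iterate_fixed h.par_root] at hk
      subst hk
      rcases hz with hz | hz
      · exact hpx.ne hz
      · exact hyp hz.symm
    · rw [hpary] at hk
      rcases hz with rfl | rfl
      · have h1 := h.iterate_depth hk hpx.ne'
        have h2 := h.dist_iterate_le hG.connected q k
        rw [hk, dist_comm] at h2
        omega
      · have h1 := h.iterate_depth hk hyp
        omega

end LeafCode

section Extremal

variable {G : SimpleGraph V}

lemma exists_adj_of_isTree [Nontrivial V] (hG : G.IsTree) (v : V) : ∃ u, G.Adj v u := by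
  obtain ⟨r, hr⟩ := exists_ne v
  obtain ⟨par, h⟩ := exists_isRooted hG r
  exact ⟨par v, h.adj_par hr.symm⟩

lemma exists_adj_ne_of_isTree [Fintype V] (hG : G.IsTree) (h3 : 3 ≤ Fintype.card V) {v s : V}
    (hv : ∀ u, G.Adj v u → u = s) : ∃ u, u ≠ v ∧ G.Adj s u := by
  classical
  by_contra! hs
  obtain ⟨par, h⟩ := exists_isRooted hG s
  have hall : ∀ n x, G.dist s x = n → x = s ∨ x = v := by
    intro n
    induction n with
    | zero =>
      intro x hx
      exact Or.inl (hG.connected.dist_eq_zero_iff.1 hx).symm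
    | succ n ih =>
      intro x hx
      have hxs : x ≠ s := by rintro rfl; simp at hx
      have hd := h.depth_par x hxs
      have hadj := h.adj_par hxs
      rcases ih (par x) (by omega) with hp | hp
      · exact Or.inr (by_contra fun hxv => hs x hxv (hp ▸ hadj.symm))
      · exact Or.inl (hv x (hp ▸ hadj.symm))
  have huniv : (Finset.univ : Finset V) ⊆ {s, v} := fun x _ => by simpa using hall _ x rfl
  have hle := (Finset.card_le_card huniv).trans Finset.card_le_two
  rw [Finset.card_univ] at hle
  omega

variable [Finite V]

lemma IsPacking.exists_adj_of_ncard_eq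
    (hsub : ∀ F ⊆ G.edgeSet, F.ncard ≤ 2 → dominationNumber (subdivide G F) ≤ dominationNumber G)
    (hadj : ∀ v, ∃ u, G.Adj v u) {S : Set V} (hS : IsPacking G S)
    (hcard : S.ncard = dominationNumber G) {v : V} (hv : v ∉ S) : ∃ s ∈ S, G.Adj v s := by
  by_contra! hvS
  obtain ⟨u, hvu⟩ := hadj v
  have huS : u ∉ S := fun hu => hvS u hu hvu
  have hF : ∀ F ⊆ G.edgeSet, F.ncard ≤ 2 → s(v, u) ∈ F →
      (∀ s ∈ S, G.Adj u s → s(u, s) ∈ F) → False := fun F hF hF2 hvuF hFu => by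
    have h1 := hS.ncard_lt_dominationNumber_subdivide hF hv huS hvuF
      (fun s hs h => (hvS s hs h).elim) hFu
    have h2 := hsub F hF hF2
    omega
  by_cases hus : ∃ s ∈ S, G.Adj u s
  · obtain ⟨s, hs, hus⟩ := hus
    refine hF {s(v, u), s(u, s)} ?_ ?_ (Or.inl rfl) ?_
    · rintro _ (rfl | rfl) <;> assumption
    · exact (Set.ncard_insert_le _ _).trans (by simp)
    · intro t ht hut
      rw [hS t ht s hs u (Or.inr hut) (Or.inr hus)]
      exact Or.inr rfl
  · push Not at hus
    refine hF {s(v, u)} ?_ (by simp) rfl (fun s hs h => (hus s hs h).elim)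
    rintro _ rfl
    exact hvu

/-- If no two subdivisions increase the domination number, then every maximum packing is a
leaf code. -/
lemma IsPacking.isLeafCode
    (hsub : ∀ F ⊆ G.edgeSet, F.ncard ≤ 2 → dominationNumber (subdivide G F) ≤ dominationNumber G)
    (hadj : ∀ v, ∃ u, G.Adj v u)
    (hadj' : ∀ v s, (∀ u, G.Adj v u → u = s) → ∃ u, u ≠ v ∧ G.Adj s u)
    {S : Set V} (hS : IsPacking G S) (hcard : S.ncard = dominationNumber G) :
    IsLeafCode G S := by
  have hdom : ∀ v ∉ S, ∃ s ∈ S, G.Adj v s := fun v hv =>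
    hS.exists_adj_of_ncard_eq hsub hadj hcard hv
  refine ⟨fun u hu v hv h => h.ne (hS u hu v hv u (Or.inl rfl) (Or.inr h)), hdom,
    fun v _ u hu w hw h1 h2 => hS u hu w hw v (Or.inr h1) (Or.inr h2), fun v hv => ?_⟩
  by_contra! hvS
  obtain ⟨s, hs, hvs⟩ := hdom v hv
  have hv1 : ∀ u, G.Adj v u → u = s := fun u hu =>
    hS u (by_contra fun h => hvS u h hu) s hs v (Or.inr hu) (Or.inr hvs)
  obtain ⟨w, hwv, hsw⟩ := hadj' v s hv1
  have hP : IsPacking G (insert v (S \ {s})) := by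
    have key : ∀ t ∈ S \ {s}, ∀ x, (x = v ∨ G.Adj x v) → ¬ (x = t ∨ G.Adj x t) := by
      rintro t ⟨ht, hts⟩ x hx hxt
      refine hts (hS t ht s hs x hxt ?_)
      rcases hx with rfl | hx
      · exact Or.inr hvs
      · exact Or.inl (hv1 x hx.symm)
    rintro a (rfl | ha) b (rfl | hb) x h1 h2
    · rfl
    · exact (key b hb x h1 h2).elim
    · exact (key a ha x h2 h1).elim
    · exact hS a ha.1 b hb.1 x h1 h2
  have hPcard : (insert v (S \ {s})).ncard = dominationNumber G := by
    rw [Set.ncard_exchange hv hs, hcard]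
  have hwS : w ∉ S := fun hw => hsw.ne (hS s hs w hw s (Or.inl rfl) (Or.inr hsw))
  obtain ⟨t, ht, hwt⟩ := hP.exists_adj_of_ncard_eq hsub hadj hPcard (v := w)
    (by rintro (h | h); exacts [hwv h, hwS h.1])
  rcases ht with rfl | ⟨ht, hts⟩
  · exact hsw.ne' (hv1 w hwt.symm)
  · exact hts (hS t ht s hs w (Or.inr hwt) (Or.inr hsw.symm))

end Extremal

section Family

section Attach

variable {W : Type*} {G : SimpleGraph W} {v : W}

@[simp] lemma attachPath2_adj_inl_inl {u w : W} :
    (attachPath2 G v).Adj (Sum.inl u) (Sum.inl w) ↔ G.Adj u w := by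
  simp only [attachPath2, fromRel_adj, G.adj_comm w u, or_self]
  exact ⟨fun h => h.2, fun h => ⟨fun e => h.ne (Sum.inl_injective e), h⟩⟩

@[simp] lemma attachPath2_adj_inl_inr {u : W} {i : Fin 2} :
    (attachPath2 G v).Adj (Sum.inl u) (Sum.inr i) ↔ u = v ∧ i = 0 := by
  simp [attachPath2]

@[simp] lemma attachPath2_adj_inr_inl {u : W} {i : Fin 2} :
    (attachPath2 G v).Adj (Sum.inr i) (Sum.inl u) ↔ u = v ∧ i = 0 := by
  simp [attachPath2]

@[simp] lemma attachPath2_adj_inr_inr {i j : Fin 2} :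
    (attachPath2 G v).Adj (Sum.inr i) (Sum.inr j) ↔ i ≠ j := by
  fin_cases i <;> fin_cases j <;> simp [attachPath2]

@[simp] lemma attachPath3_adj_inl_inl {u w : W} :
    (attachPath3 G v).Adj (Sum.inl u) (Sum.inl w) ↔ G.Adj u w := by
  simp only [attachPath3, fromRel_adj, G.adj_comm w u, or_self]
  exact ⟨fun h => h.2, fun h => ⟨fun e => h.ne (Sum.inl_injective e), h⟩⟩

@[simp] lemma attachPath3_adj_inl_inr {u : W} {i : Fin 3} :
    (attachPath3 G v).Adj (Sum.inl u) (Sum.inr i) ↔ u = v ∧ i = 0 := by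
  simp [attachPath3]

@[simp] lemma attachPath3_adj_inr_inl {u : W} {i : Fin 3} :
    (attachPath3 G v).Adj (Sum.inr i) (Sum.inl u) ↔ u = v ∧ i = 0 := by
  simp [attachPath3]

@[simp] lemma attachPath3_adj_inr_inr {i j : Fin 3} :
    (attachPath3 G v).Adj (Sum.inr i) (Sum.inr j) ↔ i.val + 1 = j.val ∨ j.val + 1 = i.val := by
  fin_cases i <;> fin_cases j <;> simp [attachPath3]

end Attach

lemma LabF.isLeafCode {W : Type} {G : SimpleGraph W} {L : Set W} (h : LabF G L) :
    IsLeafCode G L ∧ ∃ v, v ∉ L := by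
  induction h with
  | base =>
    refine ⟨⟨?_, ?_, ?_, ?_⟩, 1, by simp⟩ <;> simp only [pathGraph_adj, Set.mem_insert_iff,
      Set.mem_singleton_iff] <;> decide
  | @opA W G L v _ hv ih =>
    obtain ⟨⟨h1, h2, h3, h4⟩, w, hw⟩ := ih
    refine ⟨⟨?_, ?_, ?_, ?_⟩, Sum.inl w, by simpa using hw⟩
    · rintro (u | i) hu (w | j) hw <;> simp at hu hw ⊢ <;> grind
    · rintro (u | i) hu
      · simp at hu ⊢; grind
      · fin_cases i <;> simp at hu ⊢; exact hv
    · rintro (u | i) hu (x | j) hx (y | k) hy <;> simp at hu hx hy ⊢ <;> grind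
    · rintro (u | i) hu
      · simp at hu ⊢; grind
      · fin_cases i <;> simp [Fin.exists_fin_succ] at hu ⊢
  | @opB W G L v _ hv ih =>
    obtain ⟨⟨h1, h2, h3, h4⟩, w, hw⟩ := ih
    refine ⟨⟨?_, ?_, ?_, ?_⟩, Sum.inl w, by simpa using hw⟩
    · rintro (u | i) hu (w | j) hw <;> simp at hu hw ⊢ <;> grind
    · rintro (u | i) hu
      · simp at hu ⊢; grind
      · fin_cases i <;> simp at hu ⊢
    · rintro (u | i) hu (x | j) hx (y | k) hy <;> simp at hu hx hy ⊢ <;> grind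
    · rintro (u | i) hu
      · simp at hu ⊢; grind
      · fin_cases i <;> simp at hu ⊢; exact fun x hx e => hv (e ▸ hx)

/-- `G` with label set `L` is isomorphic to a labeled tree of the family. -/
def InFamily (G : SimpleGraph V) (L : Set V) : Prop :=
  ∃ (W : Type) (G' : SimpleGraph W) (L' : Set W), LabF G' L' ∧ ∃ f : G ≃g G', f ⁻¹' L' = L

variable {G : SimpleGraph V} {L : Set V}

lemma inFamily_of_bijective {W : Type} {G' : SimpleGraph W} {L' : Set W} (h : LabF G' L')
    (g : W → V) (hg : Function.Bijective g) (hadj : ∀ a b, G.Adj (g a) (g b) ↔ G'.Adj a b)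
    (hL : ∀ a, g a ∈ L ↔ a ∈ L') : InFamily G L := by
  refine ⟨W, G', L', h, RelIso.symm ⟨Equiv.ofBijective g hg, hadj _ _⟩, ?_⟩
  ext v
  obtain ⟨a, rfl⟩ := hg.surjective v
  rw [hL a, Set.mem_preimage]
  exact iff_of_eq (congrArg (· ∈ L') ((Equiv.ofBijective g hg).symm_apply_apply a))

lemma InFamily.of_induce_opA {K : Set V} (h : InFamily (G.induce K) (Subtype.val ⁻¹' L))
    {v x y z : V} (hvK : v ∈ K) (hvL : v ∈ L) (hK : ∀ u, u ∉ K ↔ u = x ∨ u = y ∨ u = z)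
    (hxL : x ∉ L) (hyL : y ∉ L) (hzL : z ∈ L) (hxz : ¬ G.Adj x z)
    (hx : ∀ u ∈ K, G.Adj u x ↔ u = v) (hy : ∀ u ∈ K, ¬ G.Adj u y) (hz : ∀ u ∈ K, ¬ G.Adj u z)
    (hxy : G.Adj x y) (hyz : G.Adj y z) : InFamily G L := by
  obtain ⟨W, G', L', hF, f, hf⟩ := h
  have hfL : ∀ w, (f.symm w).1 ∈ L ↔ w ∈ L' := fun w => by
    have := Set.ext_iff.1 hf (f.symm w)
    simpa using this.symm
  have hfK : ∀ w, (f.symm w).1 ∈ K := fun w => (f.symm w).2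
  have hfadj : ∀ a b, G.Adj (f.symm a).1 (f.symm b).1 ↔ G'.Adj a b := fun a b =>
    f.symm.map_adj_iff
  have hfv : ∀ w, (f.symm w).1 = v ↔ w = f ⟨v, hvK⟩ := fun w => by
    rw [← f.symm_apply_eq, Subtype.ext_iff]
  have hfinj : ∀ a b, (f.symm a).1 = (f.symm b).1 → a = b := fun a b hab =>
    f.symm.injective (Subtype.ext hab)
  refine inFamily_of_bijective (hF.opA (f ⟨v, hvK⟩) (by rw [← hfL]; simpa using hvL))
    (Sum.elim (fun w => (f.symm w).1) ![x, y, z]) ⟨?_, ?_⟩ ?_ ?_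
  · have := hxy.ne
    have := hyz.ne
    have : x ≠ z := fun e => hxL (e ▸ hzL)
    rintro (a | i) (b | j) hab
    · simp at hab ⊢; exact hfinj a b (by simpa using hab)
    · have := mt (hK (f.symm a).1).2 (not_not.2 (hfK a))
      fin_cases j <;> simp at hab <;> simp_all
    · have := mt (hK (f.symm b).1).2 (not_not.2 (hfK b))
      fin_cases i <;> simp at hab <;> simp_all
    · fin_cases i <;> fin_cases j <;> simp at hab ⊢ <;> simp_all
  · intro u
    by_cases hu : u ∈ K
    · exact ⟨Sum.inl (f ⟨u, hu⟩), by simp⟩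
    · rcases (hK u).1 hu with rfl | rfl | rfl
      · exact ⟨Sum.inr 0, rfl⟩
      · exact ⟨Sum.inr 1, rfl⟩
      · exact ⟨Sum.inr 2, rfl⟩
  · have hzx := mt G.adj_symm hxz
    rintro (a | i) (b | j)
    · simp [hfadj]
    · have := hx _ (hfK a)
      have := hy _ (hfK a)
      have := hz _ (hfK a)
      fin_cases j <;> simp <;> grind
    · have := hx _ (hfK b)
      have := hy _ (hfK b)
      have := hz _ (hfK b)
      fin_cases i <;> simp <;> grind [G.adj_comm]
    · fin_cases i <;> fin_cases j <;> simp [hxy, hyz, hxy.symm, hyz.symm, hxz, hzx]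
  · rintro (a | i)
    · simp [hfL]
    · fin_cases i <;> simp [hxL, hyL, hzL]

lemma InFamily.of_induce_opB {K : Set V} (h : InFamily (G.induce K) (Subtype.val ⁻¹' L))
    {v x y : V} (hvK : v ∈ K) (hvL : v ∉ L) (hK : ∀ u, u ∉ K ↔ u = x ∨ u = y)
    (hxL : x ∉ L) (hyL : y ∈ L) (hx : ∀ u ∈ K, G.Adj u x ↔ u = v) (hy : ∀ u ∈ K, ¬ G.Adj u y)
    (hxy : G.Adj x y) : InFamily G L := by
  obtain ⟨W, G', L', hF, f, hf⟩ := h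
  have hfL : ∀ w, (f.symm w).1 ∈ L ↔ w ∈ L' := fun w => by
    have := Set.ext_iff.1 hf (f.symm w)
    simpa using this.symm
  have hfK : ∀ w, (f.symm w).1 ∈ K := fun w => (f.symm w).2
  have hfadj : ∀ a b, G.Adj (f.symm a).1 (f.symm b).1 ↔ G'.Adj a b := fun a b =>
    f.symm.map_adj_iff
  have hfv : ∀ w, (f.symm w).1 = v ↔ w = f ⟨v, hvK⟩ := fun w => by
    rw [← f.symm_apply_eq, Subtype.ext_iff]
  have hfinj : ∀ a b, (f.symm a).1 = (f.symm b).1 → a = b := fun a b hab =>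
    f.symm.injective (Subtype.ext hab)
  refine inFamily_of_bijective (hF.opB (f ⟨v, hvK⟩) (by rw [← hfL]; simpa using hvL))
    (Sum.elim (fun w => (f.symm w).1) ![x, y]) ⟨?_, ?_⟩ ?_ ?_
  · have := hxy.ne
    rintro (a | i) (b | j) hab
    · simp at hab ⊢; exact hfinj a b (by simpa using hab)
    · have := mt (hK (f.symm a).1).2 (not_not.2 (hfK a))
      fin_cases j <;> simp at hab <;> simp_all
    · have := mt (hK (f.symm b).1).2 (not_not.2 (hfK b))
      fin_cases i <;> simp at hab <;> simp_all
    · fin_cases i <;> fin_cases j <;> simp at hab ⊢ <;> simp_all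
  · intro u
    by_cases hu : u ∈ K
    · exact ⟨Sum.inl (f ⟨u, hu⟩), by simp⟩
    · rcases (hK u).1 hu with rfl | rfl
      · exact ⟨Sum.inr 0, rfl⟩
      · exact ⟨Sum.inr 1, rfl⟩
  · rintro (a | i) (b | j)
    · simp [hfadj]
    · have := hx _ (hfK a)
      have := hy _ (hfK a)
      fin_cases j <;> simp <;> grind
    · have := hx _ (hfK b)
      have := hy _ (hfK b)
      fin_cases i <;> simp <;> grind [G.adj_comm]
    · fin_cases i <;> fin_cases j <;> simp [hxy, hxy.symm]
  · rintro (a | i)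
    · simp [hfL]
    · fin_cases i <;> simp [hxL, hyL]

lemma inFamily_of_path {a b c d : V} (hab : G.Adj a b) (hbc : G.Adj b c) (hcd : G.Adj c d)
    (hac : ¬ G.Adj a c) (had : ¬ G.Adj a d) (hbd : ¬ G.Adj b d) (hda : d ≠ a)
    (hall : ∀ u, u = a ∨ u = b ∨ u = c ∨ u = d) (haL : a ∈ L) (hbL : b ∉ L) (hcL : c ∉ L)
    (hdL : d ∈ L) : InFamily G L := by
  have hca : c ≠ a := fun e => hcL (e ▸ haL)
  have hdb : d ≠ b := fun e => hbL (e ▸ hdL)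
  refine inFamily_of_bijective LabF.base ![a, b, c, d] ⟨?_, ?_⟩ ?_ ?_
  · intro i j hij
    fin_cases i <;> fin_cases j <;>
      simp [hab.ne, hab.ne', hbc.ne, hbc.ne', hcd.ne, hcd.ne', hca, hca.symm, hda, hda.symm, hdb,
        hdb.symm] at hij ⊢
  · intro u
    rcases hall u with rfl | rfl | rfl | rfl
    exacts [⟨0, rfl⟩, ⟨1, rfl⟩, ⟨2, rfl⟩, ⟨3, rfl⟩]
  · intro i j
    rw [pathGraph_adj]
    fin_cases i <;> fin_cases j <;>
      simp [hab, hab.symm, hbc, hbc.symm, hcd, hcd.symm, hac, had, hbd, mt G.adj_symm hac,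
        mt G.adj_symm had, mt G.adj_symm hbd]
  · intro i
    fin_cases i <;> simp [haL, hbL, hcL, hdL]

lemma IsLeafCode.induce (hL : IsLeafCode G L) {K : Set V}
    (h1 : ∀ v ∈ K, v ∉ L → ∀ u ∈ L, G.Adj v u → u ∈ K)
    (h2 : ∀ v ∈ K, v ∉ L → ∃ u ∈ K, u ∉ L ∧ G.Adj v u) :
    IsLeafCode (G.induce K) (Subtype.val ⁻¹' L) where
  indep u hu v hv h := hL.indep _ hu _ hv h
  exists_mem v hv := by
    obtain ⟨u, hu, h⟩ := hL.exists_mem _ hv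
    exact ⟨⟨u, h1 _ v.2 hv u hu h⟩, hu, h⟩
  unique v hv u hu w hw h h' := Subtype.ext (hL.unique _ hv _ hu _ hw h h')
  exists_notMem v hv := by
    obtain ⟨u, huK, hu, h⟩ := h2 _ v.2 hv
    exact ⟨⟨u, huK⟩, hu, h⟩

lemma IsRooted.induce {r : V} {par : V → V} {depth : V → ℕ} (h : IsRooted G r par depth)
    {K : Set V} (hr : r ∈ K) (hK : ∀ v ∈ K, par v ∈ K) :
    IsRooted (G.induce K) ⟨r, hr⟩ (fun v => ⟨par v, hK v v.2⟩) (fun v => depth v) where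
  par_root := Subtype.ext h.par_root
  adj_iff u v := by simpa [Subtype.ext_iff] using h.adj_iff u v
  depth_par v hv := h.depth_par v (fun e => hv (Subtype.ext e))

/-- A tree with a leaf code is built by the operations of the family. A deepest vertex `a` is
removed together with its parent `b`, and possibly the parent `c` of `b`. -/
lemma IsLeafCode.inFamily_aux (n : ℕ) :
    ∀ {V : Type u} [Finite V] {G : SimpleGraph V} {L : Set V} {r : V} {par : V → V}
      {depth : V → ℕ}, Nat.card V = n → IsRooted G r par depth → IsLeafCode G L → r ∈ L →
      (∃ v, v ∉ L) → InFamily G L := by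
  induction n using Nat.strong_induction_on with
  | _ n ih =>
  intro V _ G L r par depth hn h hL hr ⟨v, hv⟩
  have hadj := h.adj_iff
  have hdep := h.depth_par
  obtain ⟨a, har, hmax⟩ := Set.exists_max_image {u | u ≠ r} depth (Set.toFinite _)
    ⟨v, fun e => hv (e ▸ hr)⟩
  simp only [Set.mem_ofPred_eq] at har hmax
  have hdeep : ∀ u, u ≠ r → depth u = depth a → ∀ w, G.Adj u w → w = par u := by
    intro u hu hd w huw
    rcases (hadj _ _).1 huw with h1 | ⟨h1, h2⟩
    · exact h1.2.symm
    · have := hdep w h1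
      have := hmax w h1
      rw [h2] at *
      omega
  have hdeepL : ∀ u, u ≠ r → depth u = depth a → u ∈ L := by
    intro u hu hd
    by_contra huL
    obtain ⟨x, hx, hux⟩ := hL.exists_mem u huL
    obtain ⟨y, hy, huy⟩ := hL.exists_notMem u huL
    rw [hdeep u hu hd x hux] at hx
    rw [hdeep u hu hd y huy] at hy
    exact hy hx
  have haL := hdeepL a har rfl
  have hab := h.adj_par har
  have haN := hdeep a har rfl
  have hda := hdep a har
  generalize par a = b at *
  have hbL : b ∉ L := fun hb => hL.indep _ haL _ hb hab
  have hbr : b ≠ r := fun e => hbL (e ▸ hr)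
  have hbc := h.adj_par hbr
  have hdb := hdep b hbr
  have hbN : ∀ u, G.Adj b u → u = a ∨ u = par b := by
    intro u hbu
    rcases (hadj _ _).1 hbu with h1 | ⟨h1, h2⟩
    · exact Or.inr h1.2.symm
    · have hdu := hdep u h1
      rw [h2] at hdu
      exact Or.inl (hL.unique b hbL u (hdeepL u h1 (by omega)) a haL hbu hab.symm)
  have hcL : par b ∉ L := by
    obtain ⟨x, hx, hbx⟩ := hL.exists_notMem b hbL
    rcases hbN x hbx with rfl | rfl
    · exact (hx haL).elim
    · exact hx
  have hparb : ∀ u, u ≠ r → par u = b → u = a := by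
    intro u hu hub
    rcases hbN u ((hadj _ _).2 (Or.inr ⟨hu, hub⟩)) with rfl | rfl
    · rfl
    · have := hdep _ hu
      rw [hub] at this
      omega
  have hpara : ∀ u, u ≠ r → par u ≠ a := by
    intro u hu hua
    have := hdep u hu
    have := hmax u hu
    rw [hua] at *
    omega
  generalize par b = c at *
  have hcr : c ≠ r := fun e => hcL (e ▸ hr)
  have hra : r ≠ a := har.symm
  have hac : a ≠ c := fun e => hcL (e ▸ haL)
  have hlt : ∀ K : Set V, a ∉ K → Nat.card K < n := fun K hK => by
    rw [← hn, Nat.card_coe_set_eq, ← Set.ncard_univ]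
    exact Set.ncard_lt_ncard ⟨Set.subset_univ K, fun hs => hK (hs (Set.mem_univ a))⟩
  by_cases hcx : ∃ x, x ∉ L ∧ x ≠ b ∧ G.Adj c x
  · obtain ⟨x, hxL, hxb, hcx⟩ := hcx
    have hrK : r ∈ {u | u ≠ b ∧ u ≠ a} := ⟨hbr.symm, hra⟩
    have hparK : ∀ u ∈ {u | u ≠ b ∧ u ≠ a}, par u ∈ {u | u ≠ b ∧ u ≠ a} := by
      rintro u ⟨hub, hua⟩
      by_cases hur : u = r
      · rw [hur, h.par_root]; exact hrK
      · exact ⟨fun e => hua (hparb u hur e), hpara u hur⟩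
    refine InFamily.of_induce_opB (K := {u | u ≠ b ∧ u ≠ a}) (v := c) (x := b) (y := a)
      (ih _ (hlt _ (by simp)) rfl (h.induce hrK hparK) (hL.induce ?_ ?_) hr
        ⟨⟨c, hbc.ne', hac.symm⟩, hcL⟩)
      ⟨hbc.ne', hac.symm⟩ hcL ?_ hbL haL ?_ ?_ hab.symm
    · rintro u ⟨hub, hua⟩ huL w hw huw
      exact ⟨fun e => hbL (e ▸ hw), fun e => hub (haN u (e ▸ huw.symm))⟩
    · rintro u ⟨hub, hua⟩ huL
      by_cases huc : u = c
      · exact ⟨x, ⟨hxb, fun e => hxL (e ▸ haL)⟩, hxL, huc ▸ hcx⟩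
      · obtain ⟨w, hw, huw⟩ := hL.exists_notMem u huL
        refine ⟨w, ⟨?_, fun e => hw (e ▸ haL)⟩, hw, huw⟩
        rintro rfl
        rcases hbN u huw.symm with h1 | h1
        exacts [hua h1, huc h1]
    · intro u
      simp only [Set.mem_ofPred_eq]
      tauto
    · rintro u ⟨hub, hua⟩
      refine ⟨fun hu => (hbN u hu.symm).resolve_left hua, ?_⟩
      rintro rfl
      exact hbc.symm
    · rintro u ⟨hub, hua⟩ hu
      exact hub (haN u hu.symm)
  · push Not at hcx
    have hcd := h.adj_par hcr
    have hdc := hdep c hcr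
    have hdb' : par c ≠ b := by
      intro e
      rw [e] at hdc
      omega
    have hdL : par c ∈ L := by
      by_contra hd
      exact hcx _ hd hdb' hcd
    have hcN : ∀ u, G.Adj c u → u = b ∨ u = par c := by
      intro u hu
      by_cases hub : u = b
      · exact Or.inl hub
      · exact Or.inr (hL.unique c hcL u (by_contra fun huL => hcx u huL hub hu) _ hdL hu hcd)
    have hparc : ∀ u, u ≠ r → par u = c → u = b := by
      intro u hu huc
      rcases hcN u ((hadj _ _).2 (Or.inr ⟨hu, huc⟩)) with h1 | rfl
      · exact h1
      · have := hdep _ hu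
        rw [huc] at this
        omega
    generalize par c = d at *
    have hda' : d ≠ a := by rintro rfl; omega
    by_cases hK : ∃ x, x ∉ L ∧ x ≠ b ∧ x ≠ c
    · obtain ⟨x, hxL, hxb, hxc⟩ := hK
      have hrK : r ∈ {u | u ≠ c ∧ u ≠ b ∧ u ≠ a} := ⟨hcr.symm, hbr.symm, hra⟩
      have hparK : ∀ u ∈ {u | u ≠ c ∧ u ≠ b ∧ u ≠ a}, par u ∈ {u | u ≠ c ∧ u ≠ b ∧ u ≠ a} := by
        rintro u ⟨huc, hub, hua⟩
        by_cases hur : u = r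
        · rw [hur, h.par_root]; exact hrK
        · exact ⟨fun e => hub (hparc u hur e), fun e => hua (hparb u hur e), hpara u hur⟩
      refine InFamily.of_induce_opA (K := {u | u ≠ c ∧ u ≠ b ∧ u ≠ a}) (v := d) (x := c) (y := b)
        (z := a) (ih _ (hlt _ (by simp)) rfl (h.induce hrK hparK) (hL.induce ?_ ?_) hr
          ⟨⟨x, hxc, hxb, fun e => hxL (e ▸ haL)⟩, hxL⟩)
        ⟨hcd.ne', hdb', hda'⟩ hdL ?_ hcL hbL haL
        (fun e => hbc.ne' (haN c e.symm)) ?_ ?_ ?_ hbc.symm hab.symm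
      · rintro u ⟨huc, hub, hua⟩ huL w hw huw
        exact ⟨fun e => hcL (e ▸ hw), fun e => hbL (e ▸ hw), fun e => hub (haN u (e ▸ huw.symm))⟩
      · rintro u ⟨huc, hub, hua⟩ huL
        obtain ⟨w, hw, huw⟩ := hL.exists_notMem u huL
        refine ⟨w, ⟨?_, ?_, fun e => hw (e ▸ haL)⟩, hw, huw⟩
        · rintro rfl
          rcases hcN u huw.symm with h1 | h1
          exacts [hub h1, huL (h1 ▸ hdL)]
        · rintro rfl
          rcases hbN u huw.symm with h1 | h1
          exacts [hua h1, huc h1]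
      · intro u
        simp only [Set.mem_ofPred_eq]
        tauto
      · rintro u ⟨huc, hub, hua⟩
        refine ⟨fun hu => (hcN u hu.symm).resolve_left hub, ?_⟩
        rintro rfl
        exact hcd.symm
      · rintro u ⟨huc, hub, hua⟩ hu
        rcases hbN u hu.symm with h1 | h1
        exacts [hua h1, huc h1]
      · rintro u ⟨huc, hub, hua⟩ hu
        exact hub (haN u hu.symm)
    · push Not at hK
      have hparL : ∀ u ∈ L, u ≠ r → u = a ∨ u = d := by
        intro u hu hur
        have hup := h.adj_par hur
        have hpL : par u ∉ L := fun hp => hL.indep _ hu _ hp hup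
        by_cases hpb : par u = b
        · exact Or.inl (hparb u hur hpb)
        · rcases hcN u ((hK _ hpL hpb) ▸ hup.symm) with rfl | h1
          exacts [(hbL hu).elim, Or.inr h1]
      have hdr : d = r := by
        by_contra hdr
        have hdp := h.adj_par hdr
        have hpL : par d ∉ L := fun hp => hL.indep _ hdL _ hp hdp
        by_cases hpb : par d = b
        · exact hda' (hparb d hdr hpb)
        · exact hdb' (hparc d hdr (hK _ hpL hpb))
      have hall : ∀ u, u = a ∨ u = b ∨ u = c ∨ u = d := by
        intro u
        by_cases hu : u ∈ L
        · by_cases hur : u = r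
          · simp [hur, hdr]
          · rcases hparL u hu hur with h1 | h1 <;> simp [h1]
        · by_cases hub : u = b
          · simp [hub]
          · simp [hK u hu hub]
      exact inFamily_of_path hab hbc hcd (fun e => hbc.ne' (haN c e)) (hL.indep _ haL _ hdL)
        (fun e => (hbN d e).elim hda' hcd.ne') hda' hall haL hbL hcL hdL

lemma IsLeafCode.memF [Finite V] (hL : IsLeafCode G L) (hG : G.IsTree) (hne : ∃ v, v ∉ L) :
    MemF G := by
  obtain ⟨v, hv⟩ := hne
  obtain ⟨r, hr, -⟩ := hL.exists_mem v hv
  obtain ⟨par, h⟩ := exists_isRooted hG r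
  obtain ⟨W, G', L', hF, f, -⟩ := IsLeafCode.inFamily_aux _ rfl h hL hr ⟨v, hv⟩
  exact ⟨W, G', L', hF, ⟨f⟩⟩

lemma MemF.exists_isLeafCode (h : MemF G) : ∃ L, IsLeafCode G L ∧ ∃ v, v ∉ L := by
  obtain ⟨W, G', L', hF, ⟨f⟩⟩ := h
  obtain ⟨hL, v, hv⟩ := hF.isLeafCode
  exact ⟨f ⁻¹' L', hL.iso f, f.symm v, by simpa using hv⟩

end Family

/-- A finite tree `T` with at least three vertices has domination
subdivision number 3 if and only if `T` belongs to the family `𝓕` of labeled trees. -/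
theorem sd_eq_three_iff_memF {V : Type u} [Fintype V]
    (T : SimpleGraph V) (hT : T.IsTree) (h3 : 3 ≤ Fintype.card V) :
    sd T = 3 ↔ MemF T := by
  constructor
  · intro hsd
    have : Nontrivial V := Fintype.one_lt_card_iff_nontrivial.1 (by omega)
    have hsub : ∀ F ⊆ T.edgeSet, F.ncard ≤ 2 →
        dominationNumber (subdivide T F) ≤ dominationNumber T := by
      intro F hF hcard
      by_contra! hlt
      have : sd T ≤ F.ncard := Nat.sInf_le ⟨F, hF, rfl, hlt⟩
      omega
    obtain ⟨par, h⟩ := exists_isRooted hT hT.connected.nonempty.some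
    obtain ⟨S, hS, hcard⟩ := h.exists_packing
    have hL := hS.isLeafCode hsub (exists_adj_of_isTree hT)
      (fun _ _ => exists_adj_ne_of_isTree hT h3) hcard
    refine hL.memF hT (by_contra fun hall => ?_)
    push Not at hall
    obtain ⟨u, hu⟩ := exists_adj_of_isTree hT hT.connected.nonempty.some
    exact hL.indep _ (hall _) _ (hall _) hu
  · intro hF
    obtain ⟨L, hL, v, hv⟩ := hF.exists_isLeafCode
    obtain ⟨F, hF, hcard, hlt⟩ := hL.sd_le_three hv
    have hle : sd T ≤ F.ncard := Nat.sInf_le ⟨F, hF, rfl, hlt⟩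
    refine (hle.trans hcard).antisymm (le_csInf ⟨_, F, hF, rfl, hlt⟩ ?_)
    rintro k ⟨F', hF', rfl, hlt'⟩
    by_contra! hk
    exact hlt'.not_ge (hL.dominationNumber_subdivide_le hT hF' (by omega))

end GenCorona
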